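/- In a Paxos-safe vote record, suppose a value v is chosen at round r, let Q be any quorum, and let r' be any round with r' > r. Then the set {s < r' | some member of Q voted at round s} is nonempty, its maximum k satisfies r ≤ k < r', and prop k = some v. In other words, after v is chosen, the highest-round vote reported by any quorum carries the value v, so a proposer performing a write-through proposes v. -/

import Mathlib

/-- `Q` is a quorum of the acceptor set `A`: a majority subset. -/
def IsQuorum {α : Type*} (A : Finset α) (Q : Finset α) : Prop :=
  Q ⊆ A ∧ A.card / 2 + 1 ≤ Q.card

/-- Every vote is for an actually issued proposal. -/
def VoteValid {α V : Type*} (prop : ℕ → Option V) (voted : α → ℕ → Prop) : Prop :=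
  ∀ a r, voted a r → prop r ≠ none

/-- Value `v` is chosen at round `r`: it is the proposal of round `r` and a quorum
voted for it. -/
def ChosenAt {α V : Type*} (A : Finset α) (prop : ℕ → Option V)
    (voted : α → ℕ → Prop) (r : ℕ) (v : V) : Prop :=
  prop r = some v ∧ ∃ Q : Finset α, IsQuorum A Q ∧ ∀ a ∈ Q, voted a r

/-- The vote record is Paxos-safe: every issued proposal of round `r` was based on a
quorum `Q` such that either no member of `Q` voted below `r`, or the proposal adopts
the value of some round `k < r` in which a member of `Q` voted, with no member of `Q`
voting strictly between `k` and `r`. -/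
def PaxosSafe {α V : Type*} (A : Finset α) (prop : ℕ → Option V)
    (voted : α → ℕ → Prop) : Prop :=
  ∀ r v, prop r = some v → ∃ Q : Finset α, IsQuorum A Q ∧
    ((∀ a ∈ Q, ∀ s < r, ¬ voted a s) ∨
     (∃ k < r, prop k = some v ∧ (∃ a ∈ Q, voted a k) ∧
        ∀ a ∈ Q, ∀ s, k < s → s < r → ¬ voted a s))


/-- Any two quorums intersect. -/
theorem IsQuorum.exists_mem_mem {α : Type*} [DecidableEq α] {A P Q : Finset α}
    (hP : IsQuorum A P) (hQ : IsQuorum A Q) : ∃ a, a ∈ P ∧ a ∈ Q := by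
  have hcard : A.card < P.card + Q.card := by
    have := hP.2
    have := hQ.2
    omega
  obtain ⟨a, ha⟩ := Finset.inter_nonempty_of_card_lt_card_add_card hP.1 hQ.1 hcard
  exact ⟨a, Finset.mem_inter.mp ha⟩

/-- Once `v` is chosen at round `r`, every proposal issued from round `r` on carries `v`. -/
theorem PaxosSafe.eq_of_chosenAt {α V : Type*} [DecidableEq α] {A : Finset α}
    {prop : ℕ → Option V} {voted : α → ℕ → Prop} (hsafe : PaxosSafe A prop voted)
    {r : ℕ} {v : V} (hchosen : ChosenAt A prop voted r v) {s : ℕ} (hs : r ≤ s) {w : V}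
    (hw : prop s = some w) : w = v := by
  obtain ⟨hr, P, hP, hvote⟩ := hchosen
  induction s using Nat.strong_induction_on with
  | _ s ih =>
    rcases hs.eq_or_lt with rfl | hlt
    · exact Option.some.inj (hw.symm.trans hr)
    · obtain ⟨Q, hQ, hcase⟩ := hsafe s w hw
      obtain ⟨a, haP, haQ⟩ := hP.exists_mem_mem hQ
      rcases hcase with hnone | ⟨k, hks, hk, -, hbetween⟩
      · exact absurd (hvote a haP) (hnone a haQ r hlt)
      · have hrk : r ≤ k := by
          by_contra! hkr
          exact hbetween a haQ r hkr hlt (hvote a haP)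
        exact ih k hks hrk hk

/-- After `v` is chosen at round `r`, for any quorum `Q` and any round `r' > r`,
the set of rounds below `r'` in which some member of `Q` voted is nonempty, its
maximum `k` satisfies `r ≤ k < r'`, and the proposal of round `k` has value `v`. -/
theorem highest_vote_of_quorum_after_chosen {α V : Type*} [DecidableEq α]
    (A : Finset α) (prop : ℕ → Option V) (voted : α → ℕ → Prop)
    (hvalid : VoteValid prop voted) (hsafe : PaxosSafe A prop voted)
    (r : ℕ) (v : V) (hchosen : ChosenAt A prop voted r v)
    (Q : Finset α) (hQ : IsQuorum A Q) (r' : ℕ) (hr' : r < r') :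
    {s : ℕ | s < r' ∧ ∃ a ∈ Q, voted a s}.Nonempty ∧
    r ≤ sSup {s : ℕ | s < r' ∧ ∃ a ∈ Q, voted a s} ∧
    sSup {s : ℕ | s < r' ∧ ∃ a ∈ Q, voted a s} < r' ∧
    prop (sSup {s : ℕ | s < r' ∧ ∃ a ∈ Q, voted a s}) = some v := by
  obtain ⟨P, hP, hvote⟩ := hchosen.2
  obtain ⟨a, haP, haQ⟩ := hP.exists_mem_mem hQ
  set S := {s : ℕ | s < r' ∧ ∃ a ∈ Q, voted a s}
  have hrS : r ∈ S := ⟨hr', a, haQ, hvote a haP⟩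
  have hbdd : BddAbove S := ⟨r', fun s hs => hs.1.le⟩
  have hle : r ≤ sSup S := le_csSup hbdd hrS
  obtain ⟨hlt, b, -, hb⟩ : sSup S ∈ S := Nat.sSup_mem ⟨r, hrS⟩ hbdd
  refine ⟨⟨r, hrS⟩, hle, hlt, ?_⟩
  obtain ⟨w, hw⟩ := Option.ne_none_iff_exists'.mp (hvalid b _ hb)
  rw [hw, hsafe.eq_of_chosenAt hchosen hle hw]
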